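/- First order homogenized model (Theorem 1). Define the corrected characteristic speed λ_B^{(1)} = λ_B^{(0)} − ε λ_B^{(0)} cᵀ A⁻² g. For every M > 0 and T₀ > 0 there exist C > 0 and ε₀ > 0, depending only on l, A, X, Λ, g, c, δ, M and T₀, such that the following holds for every ε ∈ (0, ε₀]: if (U, B) is a bounded C² classical solution of the system on ℝ × [0, T₀/ε] with all partial derivatives up to order two bounded by M, B₀ := B(·,0) ∈ W^{2,∞}(ℝ) with ‖B₀‖_{W^{2,∞}} ≤ M, and if (1) sup_x |(A + ε X⁻¹ Λ X̂) U_x(x,0) + (g + ε X⁻¹ Λ α̂) B_x(x,0)| ≤ M ε² and (2) sup_x |A U_{xx}(x,0) + g B_{xx}(x,0)| ≤ M ε, then sup_{x∈ℝ, 0 ≤ t ≤ T₀/ε} |B(x,t) − B₀(x − λ_B^{(1)} ε t)| ≤ C ε². -/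

import Mathlib

open Matrix Set
set_option maxHeartbeats 4000000

lemma aux_transport (f fx ft : ℝ → ℝ → ℝ) (T d E : ℝ) (hT : 0 < T)
    (hf : DifferentiableOn ℝ (fun p : ℝ × ℝ => f p.1 p.2) (univ ×ˢ Icc (0:ℝ) T))
    (hx : ∀ x : ℝ, ∀ t ∈ Icc (0:ℝ) T, HasDerivAt (fun x' => f x' t) (fx x t) x)
    (ht : ∀ x : ℝ, ∀ t ∈ Icc (0:ℝ) T,
      HasDerivWithinAt (fun t' => f x t') (ft x t) (Icc 0 T) t)
    (hE : ∀ x : ℝ, ∀ t ∈ Icc (0:ℝ) T, |ft x t + d * fx x t| ≤ E)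
    (x t : ℝ) (htt : t ∈ Icc (0:ℝ) T) : |f x t - f (x - d * t) 0| ≤ E * t := by
  have key : ∀ s ∈ Icc (0:ℝ) T, HasDerivWithinAt (fun s => f (x - d * (t - s)) s)
      (ft (x - d * (t - s)) s + d * fx (x - d * (t - s)) s) (Icc 0 T) s := by
    intro s hs
    set y := x - d * (t - s) with hy
    obtain ⟨L, hL⟩ := hf (y, s) ⟨mem_univ _, hs⟩
    have h1 : L (1, 0) = fx y s := by
      have hc : HasDerivAt (fun x' : ℝ => ((x', s) : ℝ × ℝ)) (1, 0) y :=
        (hasDerivAt_id y).prodMk (hasDerivAt_const y s)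
      have := HasFDerivWithinAt.comp_hasDerivWithinAt (f := fun x' : ℝ => ((x', s) : ℝ × ℝ)) (s := univ) y hL
        hc.hasDerivWithinAt (fun x' _ => ⟨mem_univ _, hs⟩)
      exact (hasDerivWithinAt_univ.1 this).unique (hx y s hs)
    have h2 : L (0, 1) = ft y s := by
      have hc : HasDerivAt (fun t' : ℝ => ((y, t') : ℝ × ℝ)) (0, 1) s :=
        (hasDerivAt_const s y).prodMk (hasDerivAt_id s)
      have := hL.comp_hasDerivWithinAt (s := Icc 0 T) s hc.hasDerivWithinAt
        (fun t' h => ⟨mem_univ _, h⟩)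
      exact ((uniqueDiffOn_Icc hT) s hs).eq_deriv _ this (ht y s hs)
    have hc : HasDerivAt (fun s' : ℝ => ((x - d * (t - s'), s') : ℝ × ℝ)) (d, 1) s := by
      refine HasDerivAt.prodMk ?_ (hasDerivAt_id s)
      have := (((hasDerivAt_id s).const_sub t).const_mul d).const_sub x
      simpa using this
    have := HasFDerivWithinAt.comp_hasDerivWithinAt
        (f := fun s' : ℝ => ((x - d * (t - s'), s') : ℝ × ℝ)) (s := Icc 0 T) s hL
        hc.hasDerivWithinAt (fun t' h => ⟨mem_univ _, h⟩)
    have h3 : L (d, 1) = ft y s + d * fx y s := by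
      have : ((d, 1) : ℝ × ℝ) = (0, 1) + d • (1, 0) := by simp
      rw [this, map_add, map_smul, h1, h2, smul_eq_mul]
    rw [h3] at this
    exact this
  have := Convex.norm_image_sub_le_of_norm_hasDerivWithin_le (C := E) key
    (fun s hs => by rw [Real.norm_eq_abs]; exact hE _ s hs) (convex_Icc 0 T)
    (left_mem_Icc.2 hT.le) htt
  simpa [Real.norm_eq_abs, abs_of_nonneg htt.1] using this

lemma aux_speed (q μ l0 κ s1 s2 ε M C2 C3 : ℝ) (hε : 0 < ε) (hq : 1/2 ≤ q)
    (hμ : |μ| ≤ M) (h1 : μ * q = l0 * q + ε * μ * s1)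
    (h2 : s1 = -κ * q + ε * μ * s2) (hs1 : |s1| ≤ C2) (hs2 : |s2| ≤ C3) :
    |μ - (l0 - ε * l0 * κ)| ≤ ε ^ 2 * (2 * |κ| * M * C2 + 2 * M ^ 2 * C3) := by
  have hM : 0 ≤ M := (abs_nonneg _).trans hμ
  have hq0 : 0 < q := by linarith
  have e1 : μ - l0 = ε * (μ * s1) * q⁻¹ := by field_simp; linarith
  have hqi : |q⁻¹| ≤ 2 := by
    rw [abs_of_pos (inv_pos.2 hq0)]
    rw [inv_le_comm₀ hq0 (by norm_num)]; linarith
  have e2 : μ - (l0 - ε * l0 * κ) = ε ^ 2 * (-(κ * (μ * s1 * q⁻¹)) + μ ^ 2 * s2 * q⁻¹) := by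
    have : μ - l0 = - (ε * μ * κ) + ε ^ 2 * (μ ^ 2 * s2 * q⁻¹) := by
      rw [e1, h2]; field_simp
    have h3 : κ * (μ * s1 * q⁻¹) * ε = κ * (μ - l0) := by rw [e1]; ring
    linear_combination this + ε * h3
  rw [e2, abs_mul, abs_of_pos (by positivity : 0 < ε ^ 2)]
  gcongr
  refine (abs_add_le _ _).trans ?_
  have b1 : |μ * s1| ≤ M * C2 := by rw [abs_mul]; gcongr
  have b2 : |μ ^ 2 * s2| ≤ M ^ 2 * C3 := by rw [abs_mul, abs_pow]; gcongr
  have b3 : |μ * s1 * q⁻¹| ≤ M * C2 * 2 := by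
    rw [abs_mul]
    exact mul_le_mul b1 hqi (abs_nonneg _) ((abs_nonneg _).trans b1)
  have b4 : |μ ^ 2 * s2 * q⁻¹| ≤ M ^ 2 * C3 * 2 := by
    rw [abs_mul]
    exact mul_le_mul b2 hqi (abs_nonneg _) ((abs_nonneg _).trans b2)
  rw [abs_neg, abs_mul]
  have := mul_le_mul_of_nonneg_left b3 (abs_nonneg κ)
  linarith

lemma aux_dot {l : ℕ} (u p : Fin l → ℝ) (M : ℝ) (hp : ∀ i, |p i| ≤ M) :
    |u ⬝ᵥ p| ≤ (∑ i, |u i|) * M := by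
  rw [dotProduct, Finset.sum_mul]
  refine (Finset.abs_sum_le_sum_abs _ _).trans (Finset.sum_le_sum fun i _ => ?_)
  rw [abs_mul]
  exact mul_le_mul_of_nonneg_left (hp i) (abs_nonneg _)

lemma aux_mulVec {l : ℕ} (P : Matrix (Fin l) (Fin l) ℝ) :
    ∃ C1 ≥ (0:ℝ), ∀ v, ‖P *ᵥ v‖ ≤ C1 * ‖v‖ :=
  ⟨‖(Matrix.mulVecLin P).toContinuousLinearMap‖, norm_nonneg _,
    fun v => (Matrix.mulVecLin P).toContinuousLinearMap.le_opNorm v⟩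

/-- First order homogenized model (Theorem 1): with the corrected
characteristic speed `λ_B¹ = λ_B⁰ − ε λ_B⁰ cᵀ A⁻² g`, `λ_B⁰ = −cᵀ A⁻¹ g`,
and under the eigenvalue-perturbation decomposition `C^ε = (K^ε)⁻¹ D^ε K^ε`
with perturbation quantities bounded by `M`, every bounded `C²` solution of
`U_t + A U_x = −g B_x`, `B_t + ε cᵀ U_x = 0` on `ℝ × [0, T₀/ε]` with
derivatives up to order two bounded by `M`, satisfying the initial conditions
(1)–(2) and `B₀ = B(·,0) ∈ W^{2,∞}` with norm at most `M`, stays within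
`C ε²` of `B₀(x − λ_B¹ ε t)`. -/
theorem stmt_3 (l : ℕ) (A X : Matrix (Fin l) (Fin l) ℝ) (lam : Fin l → ℝ)
    (g c : Fin l → ℝ) (δ : ℝ) (hδ : 0 < δ)
    (hX : IsUnit X) (hA : A = X⁻¹ * Matrix.diagonal lam * X)
    (hdistinct : ∀ i j : Fin l, i ≠ j → lam i ≠ lam j)
    (hlam : ∀ i : Fin l, δ ≤ |lam i|)
    (M T₀ : ℝ) (hM : 0 < M) (hT₀ : 0 < T₀) :
    ∃ C > 0, ∃ ε₀ > 0, ∀ ε : ℝ, 0 < ε → ε ≤ ε₀ →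
      ∀ (Xhat : Matrix (Fin l) (Fin l) ℝ) (αhat βhat lamhat : Fin l → ℝ)
        (θhat μ : ℝ) (Kmat Dmat : Matrix (Fin l ⊕ Unit) (Fin l ⊕ Unit) ℝ),
        -- the perturbed eigenvector and eigenvalue matrices K^ε and D^ε
        Kmat = Matrix.fromBlocks (X + ε • Xhat)
            (Matrix.of fun i _ =>
              (Matrix.diagonal lam)⁻¹.mulVec (X.mulVec g) i + ε * αhat i)
            (Matrix.of fun _ j => ε * βhat j)
            (Matrix.of fun _ _ => 1 + ε * θhat) →
        Dmat = Matrix.fromBlocks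
            (Matrix.diagonal lam + ε • Matrix.diagonal lamhat) 0 0
            (Matrix.of fun _ _ => ε * μ) →
        IsUnit Kmat →
        -- the exact similarity C^ε = (K^ε)⁻¹ D^ε K^ε
        Matrix.fromBlocks A (Matrix.of fun i _ => g i)
            (Matrix.of fun _ j => ε * c j) 0 = Kmat⁻¹ * Dmat * Kmat →
        -- the perturbation quantities and (K^ε)⁻¹ are bounded by M
        (∀ i j, |Xhat i j| ≤ M) → (∀ i, |αhat i| ≤ M) → (∀ i, |βhat i| ≤ M) →
        (∀ i, |lamhat i| ≤ M) → |θhat| ≤ M → |μ| ≤ M →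
        (∀ i j, |Kmat⁻¹ i j| ≤ M) →
        ∀ (U : ℝ → ℝ → Fin l → ℝ) (B : ℝ → ℝ → ℝ)
          (Ux Ut Uxx Uxt Utt : ℝ → ℝ → Fin l → ℝ)
          (Bx Bt Bxx Bxt Btt : ℝ → ℝ → ℝ),
          -- (U, B) is a C² classical solution on ℝ × [0, T₀/ε]
          (∀ x : ℝ, ∀ t ∈ Icc (0 : ℝ) (T₀ / ε),
            HasDerivAt (fun x' => U x' t) (Ux x t) x ∧
            HasDerivWithinAt (fun t' => U x t') (Ut x t) (Icc 0 (T₀ / ε)) t ∧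
            HasDerivAt (fun x' => B x' t) (Bx x t) x ∧
            HasDerivWithinAt (fun t' => B x t') (Bt x t) (Icc 0 (T₀ / ε)) t) →
          (∀ x : ℝ, ∀ t ∈ Icc (0 : ℝ) (T₀ / ε),
            HasDerivAt (fun x' => Ux x' t) (Uxx x t) x ∧
            HasDerivWithinAt (fun t' => Ux x t') (Uxt x t) (Icc 0 (T₀ / ε)) t ∧
            HasDerivWithinAt (fun t' => Ut x t') (Utt x t) (Icc 0 (T₀ / ε)) t ∧
            HasDerivAt (fun x' => Bx x' t) (Bxx x t) x ∧
            HasDerivWithinAt (fun t' => Bx x t') (Bxt x t) (Icc 0 (T₀ / ε)) t ∧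
            HasDerivWithinAt (fun t' => Bt x t') (Btt x t) (Icc 0 (T₀ / ε)) t) →
          -- joint C² regularity of the solution on ℝ × [0, T₀/ε]
          ContDiffOn ℝ 2 (fun p : ℝ × ℝ => U p.1 p.2)
            (univ ×ˢ Icc (0:ℝ) (T₀ / ε)) →
          ContDiffOn ℝ 2 (fun p : ℝ × ℝ => B p.1 p.2)
            (univ ×ˢ Icc (0:ℝ) (T₀ / ε)) →
          -- boundedness of the solution
          (∃ K : ℝ, ∀ x : ℝ, ∀ t ∈ Icc (0 : ℝ) (T₀ / ε),
            ‖U x t‖ ≤ K ∧ |B x t| ≤ K) →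
          -- all partial derivatives up to order two bounded by M
          (∀ x : ℝ, ∀ t ∈ Icc (0 : ℝ) (T₀ / ε),
            ‖Ux x t‖ ≤ M ∧ ‖Ut x t‖ ≤ M ∧ ‖Uxx x t‖ ≤ M ∧ ‖Uxt x t‖ ≤ M ∧
            ‖Utt x t‖ ≤ M ∧ |Bx x t| ≤ M ∧ |Bt x t| ≤ M ∧ |Bxx x t| ≤ M ∧
            |Bxt x t| ≤ M ∧ |Btt x t| ≤ M) →
          -- the linear hyperbolic system
          (∀ x : ℝ, ∀ t ∈ Icc (0 : ℝ) (T₀ / ε),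
            Ut x t + A.mulVec (Ux x t) = -(Bx x t) • g ∧
            Bt x t + ε * (c ⬝ᵥ Ux x t) = 0) →
          -- initial condition (1)
          (∀ x : ℝ,
            ‖(A + ε • (X⁻¹ * Matrix.diagonal lam * Xhat)).mulVec (Ux x 0)
              + Bx x 0 • (g + ε • (X⁻¹ * Matrix.diagonal lam).mulVec αhat)‖
              ≤ M * ε ^ 2) →
          -- initial condition (2)
          (∀ x : ℝ, ‖A.mulVec (Uxx x 0) + Bxx x 0 • g‖ ≤ M * ε) →
          -- B₀ = B(·,0) ∈ W^{2,∞}(ℝ) with norm ≤ M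
          (∀ x : ℝ, |B x 0| ≤ M ∧ |Bx x 0| ≤ M ∧ |Bxx x 0| ≤ M) →
          ∀ x : ℝ, ∀ t ∈ Icc (0 : ℝ) (T₀ / ε),
            |B x t -
              B (x - (-(c ⬝ᵥ A⁻¹.mulVec g)
                  - ε * -(c ⬝ᵥ A⁻¹.mulVec g) * (c ⬝ᵥ (A⁻¹ * A⁻¹).mulVec g))
                * ε * t) 0| ≤ C * ε ^ 2 := by
  classical
  have hl0 : ∀ i, lam i ≠ 0 := fun i h => by
    have := hlam i
    rw [h, abs_zero] at this
    linarith
  have hΛu : IsUnit (Matrix.diagonal lam).det := by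
    rw [Matrix.det_diagonal]
    exact isUnit_iff_ne_zero.2 (Finset.prod_ne_zero_iff.2 fun i _ => hl0 i)
  have hXu : IsUnit X.det := (Matrix.isUnit_iff_isUnit_det _).1 hX
  have hAu : IsUnit A.det := by
    rw [hA, Matrix.det_mul, Matrix.det_mul]
    exact ((Matrix.isUnit_nonsing_inv_det _ hXu).mul hΛu).mul hXu
  obtain ⟨C1, hC1, hC1b⟩ := aux_mulVec ((Matrix.diagonal lam)⁻¹ * X)
  set κ := c ⬝ᵥ (A⁻¹ * A⁻¹).mulVec g with hκ
  set l0 := -(c ⬝ᵥ A⁻¹.mulVec g) with hl0def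
  set cs := ∑ i, |c i| with hcs
  have hcs0 : 0 ≤ cs := Finset.sum_nonneg fun i _ => abs_nonneg _
  set C2 := (∑ i, |(c ᵥ* A⁻¹) i|) * M with hC2
  set C3 := (∑ i, |(c ᵥ* (A⁻¹ * A⁻¹)) i|) * M with hC3
  have hC2' : 0 ≤ C2 := mul_nonneg (Finset.sum_nonneg fun i _ => abs_nonneg _) hM.le
  have hC3' : 0 ≤ C3 := mul_nonneg (Finset.sum_nonneg fun i _ => abs_nonneg _) hM.le
  clear_value κ l0 cs C2 C3
  set E1 := (l:ℝ) * ((cs * M + M * M) * (C1 * M)) with hE1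
  have hE1' : 0 ≤ E1 := by rw [hE1]; positivity
  set E2 := 2 * |κ| * M * C2 + 2 * M ^ 2 * C3 with hE2
  have hE2' : 0 ≤ E2 := by rw [hE2]; positivity
  clear_value E1 E2
  refine ⟨E1 * T₀ + M * E2 * T₀ + 1, by positivity, 1 / (2 * (l * M ^ 2 + M ^ 2)), by positivity, ?_⟩
  intro ε hε hεle Xhat αhat βhat lamhat θhat μ K D hK hD hKu hsim hXhat hαhat hβhat hlamhat hθ hμ hKinv
    U B Ux Ut Uxx Uxt Utt Bx Bt Bxx Bxt Btt hd1 _ hUc hBc _ hbd hsys hic1 _ hB0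
  have hKd : IsUnit K.det := (Matrix.isUnit_iff_isUnit_det _).1 hKu
  have hT : 0 < T₀ / ε := by positivity
  set J := K⁻¹ with hJ
  have hKJ : K * J = 1 := Matrix.mul_nonsing_inv _ hKd
  have hJK : J * K = 1 := Matrix.nonsing_inv_mul _ hKd
  set Cm : Matrix (Fin l ⊕ Unit) (Fin l ⊕ Unit) ℝ :=
    Matrix.fromBlocks A (Matrix.of fun i _ => g i) (Matrix.of fun _ j => ε * c j) 0 with hCm
  have hKC : K * Cm = D * K := by
    rw [hsim, ← Matrix.mul_assoc, ← Matrix.mul_assoc, hKJ, Matrix.one_mul]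
  have hCJ : Cm * J = J * D := by
    rw [hsim, Matrix.mul_assoc, hKJ, Matrix.mul_one]
  set p : Fin l → ℝ := fun i => J (Sum.inl i) (Sum.inr ()) with hp
  set q : ℝ := J (Sum.inr ()) (Sum.inr ()) with hq
  have hpb : ∀ i, |p i| ≤ M := fun i => hKinv _ _
  have eqA : A *ᵥ p + q • g = (ε * μ) • p := by
    funext i
    have := congrFun (congrFun hCJ (Sum.inl i)) (Sum.inr ())
    simp only [Matrix.mul_apply, Fintype.sum_sum_type, hCm, hD] at this
    simp at this
    simp only [Pi.add_apply, Pi.smul_apply, smul_eq_mul, Matrix.mulVec, dotProduct, hp, hq]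
    linarith
  have eqc : c ⬝ᵥ p = μ * q := by
    have := congrFun (congrFun hCJ (Sum.inr ())) (Sum.inr ())
    simp only [Matrix.mul_apply, Fintype.sum_sum_type, hCm, hD] at this
    simp [mul_assoc, ← Finset.mul_sum] at this
    simp only [dotProduct, hp, hq]
    have h' : ε * (∑ i, c i * J (Sum.inl i) (Sum.inr ())) = ε * (μ * J (Sum.inr ()) (Sum.inr ())) := by
      linarith
    exact mul_left_cancel₀ hε.ne' h'
  have hqq : 1 / 2 ≤ q := by
    have := congrFun (congrFun hKJ (Sum.inr ())) (Sum.inr ())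
    simp only [Matrix.mul_apply, Fintype.sum_sum_type, hK] at this
    simp [mul_assoc, ← Finset.mul_sum] at this
    have b1 : |βhat ⬝ᵥ p| ≤ l * M ^ 2 := by
      refine (aux_dot βhat p M hpb).trans ?_
      have : ∑ i, |βhat i| ≤ ∑ i : Fin l, M := Finset.sum_le_sum fun i _ => hβhat i
      simp at this
      nlinarith
    have b2 : |θhat * q| ≤ M ^ 2 := by
      rw [abs_mul, sq]
      exact mul_le_mul hθ (hKinv _ _) (abs_nonneg _) hM.le
    have b3 : ε * (l * M ^ 2 + M ^ 2) ≤ 1 / 2 := by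
      have : 0 < l * M ^ 2 + M ^ 2 := by positivity
      rw [le_div_iff₀ (by positivity)] at hεle
      linarith
    have e : ε * (βhat ⬝ᵥ p) + (1 + ε * θhat) * q = 1 := by
      simpa [dotProduct, hp, hq] using this
    have b4 : βhat ⬝ᵥ p + θhat * q ≤ l * M ^ 2 + M ^ 2 :=
      add_le_add ((le_abs_self _).trans b1) ((le_abs_self _).trans b2)
    have b5 := mul_le_mul_of_nonneg_left b4 hε.le
    linarith
  have hAA : A⁻¹ * A = 1 := Matrix.nonsing_inv_mul _ hAu
  have ep : p = -(q • (A⁻¹ *ᵥ g)) + (ε * μ) • (A⁻¹ *ᵥ p) := by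
    have := congrArg (fun v => A⁻¹ *ᵥ v) eqA
    simp only [Matrix.mulVec_add, Matrix.mulVec_smul, Matrix.mulVec_mulVec, hAA,
      Matrix.one_mulVec] at this
    rw [← this]; abel
  have hspeed : |μ - (l0 - ε * l0 * κ)| ≤ ε ^ 2 * E2 := by
    rw [hE2]
    refine aux_speed q μ l0 κ (c ⬝ᵥ A⁻¹ *ᵥ p) (c ⬝ᵥ (A⁻¹ * A⁻¹) *ᵥ p) ε M C2 C3 hε hqq hμ ?_ ?_ ?_ ?_
    · rw [← eqc]
      conv_lhs => rw [ep]
      rw [dotProduct_add, dotProduct_neg, dotProduct_smul, dotProduct_smul]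
      simp only [smul_eq_mul, hl0def]
      ring
    · conv_lhs => rw [ep]
      rw [Matrix.mulVec_add, Matrix.mulVec_neg, Matrix.mulVec_smul, Matrix.mulVec_smul,
        Matrix.mulVec_mulVec, Matrix.mulVec_mulVec,
        dotProduct_add, dotProduct_neg, dotProduct_smul, dotProduct_smul]
      simp only [smul_eq_mul, hκ]
      ring
    · rw [Matrix.dotProduct_mulVec]; (first | rw [hC2] | rw [hC3]); exact aux_dot _ _ _ hpb
    · rw [Matrix.dotProduct_mulVec, hC3]; exact aux_dot _ _ _ hpb
  -- characteristic variables
  set z : ℝ → ℝ → Fin l ⊕ Unit → ℝ := fun x t => Sum.elim (U x t) (fun _ => B x t) with hz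
  set zx : ℝ → ℝ → Fin l ⊕ Unit → ℝ := fun x t => Sum.elim (Ux x t) (fun _ => Bx x t) with hzx
  set zt : ℝ → ℝ → Fin l ⊕ Unit → ℝ := fun x t => Sum.elim (Ut x t) (fun _ => Bt x t) with hzt
  have hzeq : ∀ x : ℝ, ∀ t ∈ Icc (0:ℝ) (T₀ / ε), zt x t = -(Cm *ᵥ zx x t) := by
    intro x t ht
    obtain ⟨h1, h2⟩ := hsys x t ht
    funext k
    rcases k with i | k
    · have := congrFun h1 i
      simp [Matrix.mulVec, dotProduct] at this
      simp [hzt, hzx, hCm, Matrix.mulVec, dotProduct, Fintype.sum_sum_type]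
      linarith
    · simp [dotProduct] at h2
      simp [hzt, hzx, hCm, Matrix.mulVec, dotProduct, Fintype.sum_sum_type, mul_assoc,
        ← Finset.mul_sum]
      linarith
  have hzdx : ∀ x : ℝ, ∀ t ∈ Icc (0:ℝ) (T₀ / ε), ∀ j,
      HasDerivAt (fun x' => z x' t j) (zx x t j) x := by
    intro x t ht j
    obtain ⟨h1, _, h3, _⟩ := hd1 x t ht
    rcases j with i | k
    · exact (hasDerivAt_pi.1 h1) i
    · exact h3
  have hzdt : ∀ x : ℝ, ∀ t ∈ Icc (0:ℝ) (T₀ / ε), ∀ j,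
      HasDerivWithinAt (fun t' => z x t' j) (zt x t j) (Icc 0 (T₀ / ε)) t := by
    intro x t ht j
    obtain ⟨_, h2, _, h4⟩ := hd1 x t ht
    rcases j with i | k
    · exact (hasDerivWithinAt_pi.1 h2) i
    · exact h4
  have hzd : ∀ j, DifferentiableOn ℝ (fun p : ℝ × ℝ => z p.1 p.2 j)
      (univ ×ˢ Icc (0:ℝ) (T₀ / ε)) := by
    intro j
    rcases j with i | k
    · exact (differentiableOn_pi.1 (hUc.differentiableOn (by norm_num))) i
    · exact hBc.differentiableOn (by norm_num)
  have hwdx : ∀ x : ℝ, ∀ t ∈ Icc (0:ℝ) (T₀ / ε), ∀ j,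
      HasDerivAt (fun x' => (K *ᵥ z x' t) j) ((K *ᵥ zx x t) j) x := by
    intro x t ht j
    simp only [Matrix.mulVec, dotProduct]
    exact HasDerivAt.fun_sum fun i _ => (hzdx x t ht i).const_mul _
  have hwtr : ∀ x : ℝ, ∀ t ∈ Icc (0:ℝ) (T₀ / ε), ∀ i : Fin l,
      (K *ᵥ z x t) (Sum.inl i) = (K *ᵥ z (x - (lam i + ε * lamhat i) * t) 0) (Sum.inl i) := by
    intro x t ht i
    have := aux_transport (fun x t => (K *ᵥ z x t) (Sum.inl i))
      (fun x t => (K *ᵥ zx x t) (Sum.inl i)) (fun x t => (K *ᵥ zt x t) (Sum.inl i))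
      (T₀ / ε) (lam i + ε * lamhat i) 0 hT ?_ (fun x t ht => hwdx x t ht _) ?_ ?_ x t ht
    · rw [zero_mul] at this
      exact sub_eq_zero.1 (abs_nonpos_iff.1 this)
    · simp only [Matrix.mulVec, dotProduct]
      exact DifferentiableOn.fun_sum fun j _ => (hzd j).const_mul _
    · intro x t ht
      simp only [Matrix.mulVec, dotProduct]
      exact HasDerivWithinAt.fun_sum fun j _ => (hzdt x t ht j).const_mul _
    · intro x t ht
      apply le_of_eq
      rw [abs_eq_zero, hzeq x t ht, Matrix.mulVec_neg, Matrix.mulVec_mulVec, hKC,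
        ← Matrix.mulVec_mulVec]
      generalize K *ᵥ zx x t = w
      simp [hD, Matrix.mulVec, dotProduct, Fintype.sum_sum_type, Matrix.diagonal_apply, add_mul,
        Finset.sum_add_distrib]
  have hw0 : ∀ x : ℝ, ∀ i : Fin l, |(K *ᵥ zx x 0) (Sum.inl i)| ≤ C1 * M * ε ^ 2 := by
    intro x i
    have h := hic1 x
    set v := (A + ε • (X⁻¹ * Matrix.diagonal lam * Xhat)).mulVec (Ux x 0)
              + Bx x 0 • (g + ε • (X⁻¹ * Matrix.diagonal lam).mulVec αhat) with hv
    set Li := (Matrix.diagonal lam)⁻¹ with hLi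
    have hR : (Li * X) * (X⁻¹ * Matrix.diagonal lam) = 1 := by
      rw [Matrix.mul_assoc, ← Matrix.mul_assoc X, Matrix.mul_nonsing_inv _ hXu, Matrix.one_mul,
        Matrix.nonsing_inv_mul _ hΛu]
    have hvv : (Li * X) *ᵥ v = (X + ε • Xhat) *ᵥ (Ux x 0) +
        Bx x 0 • (Li *ᵥ (X *ᵥ g) + ε • αhat) := by
      rw [hv, hA]
      have hR2 : Li * X * X⁻¹ * Matrix.diagonal lam = 1 := by
        rw [← hR, Matrix.mul_assoc (Li * X)]
      simp only [Matrix.mulVec_add, Matrix.mulVec_smul, Matrix.mulVec_mulVec, Matrix.mul_add,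
        Matrix.mul_smul, ← Matrix.mul_assoc, hR2, Matrix.one_mul, Matrix.one_mulVec]
    have : (K *ᵥ zx x 0) (Sum.inl i) = ((Li * X) *ᵥ v) i := by
      rw [hvv, hK]
      generalize Li *ᵥ (X *ᵥ g) = u
      simp [hzx, Matrix.mulVec, dotProduct, Fintype.sum_sum_type]
      ring
    rw [this, ← Real.norm_eq_abs]
    calc _ ≤ ‖(Li * X) *ᵥ v‖ := norm_le_pi_norm _ i
      _ ≤ C1 * ‖v‖ := hC1b v
      _ ≤ C1 * (M * ε ^ 2) := mul_le_mul_of_nonneg_left h hC1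
      _ = _ := by ring
  have h0T : (0:ℝ) ∈ Icc (0:ℝ) (T₀ / ε) := left_mem_Icc.2 hT.le
  have hwt : ∀ x : ℝ, ∀ t ∈ Icc (0:ℝ) (T₀ / ε), ∀ i : Fin l,
      |(K *ᵥ zx x t) (Sum.inl i)| ≤ C1 * M * ε ^ 2 := by
    intro x t ht i
    have h1 := hwdx x t ht (Sum.inl i)
    have h2 := (hwdx (x - (lam i + ε * lamhat i) * t) 0 h0T (Sum.inl i)).comp_sub_const x
      ((lam i + ε * lamhat i) * t)
    have h3 : (fun x' => (K *ᵥ z x' t) (Sum.inl i)) = fun x' =>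
      (K *ᵥ z (x' - (lam i + ε * lamhat i) * t) 0) (Sum.inl i) :=
      funext fun x' => hwtr x' t ht i
    rw [h3] at h1
    rw [h1.unique h2]
    exact hw0 _ i
  have hE : ∀ x : ℝ, ∀ t ∈ Icc (0:ℝ) (T₀ / ε),
      |Bt x t + (ε * μ) * Bx x t| ≤ ε ^ 3 * E1 := by
    intro x t ht
    have hzr : zx x t = J *ᵥ (K *ᵥ zx x t) := by
      rw [Matrix.mulVec_mulVec, hJK, Matrix.one_mulVec]
    have hw := hwt x t ht
    set w := K *ᵥ zx x t with hwdef
    have hU : Ux x t = fun i => (∑ k, J (Sum.inl i) (Sum.inl k) * w (Sum.inl k))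
        + p i * w (Sum.inr ()) := by
      funext i
      have := congrFun hzr (Sum.inl i)
      simpa [hzx, Matrix.mulVec, dotProduct, Fintype.sum_sum_type] using this
    have hB : Bx x t = (∑ k, J (Sum.inr ()) (Sum.inl k) * w (Sum.inl k))
        + q * w (Sum.inr ()) := by
      have := congrFun hzr (Sum.inr ())
      simpa [hzx, Matrix.mulVec, dotProduct, Fintype.sum_sum_type] using this
    have hcU : c ⬝ᵥ Ux x t = (∑ k, (c ⬝ᵥ fun i => J (Sum.inl i) (Sum.inl k)) * w (Sum.inl k))
        + (c ⬝ᵥ p) * w (Sum.inr ()) := by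
      rw [hU]
      simp only [dotProduct, mul_add, Finset.sum_add_distrib, Finset.mul_sum, Finset.sum_mul]
      rw [Finset.sum_comm]
      simp only [mul_assoc]
    have hBt : Bt x t = -(ε * (c ⬝ᵥ Ux x t)) := by
      have := (hsys x t ht).2
      linarith
    have e : Bt x t + (ε * μ) * Bx x t = ε * ∑ k, ((-(c ⬝ᵥ fun i => J (Sum.inl i) (Sum.inl k))
        + μ * J (Sum.inr ()) (Sum.inl k)) * w (Sum.inl k)) := by
      rw [hBt, hcU, hB, eqc]
      simp only [add_mul, Finset.sum_add_distrib, neg_mul, Finset.sum_neg_distrib, mul_assoc,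
        ← Finset.mul_sum]
      ring
    rw [e, abs_mul, abs_of_pos hε]
    have : |∑ k, ((-(c ⬝ᵥ fun i => J (Sum.inl i) (Sum.inl k))
        + μ * J (Sum.inr ()) (Sum.inl k)) * w (Sum.inl k))| ≤
        ∑ k : Fin l, (cs * M + M * M) * (C1 * M * ε ^ 2) := by
      refine (Finset.abs_sum_le_sum_abs _ _).trans (Finset.sum_le_sum fun k _ => ?_)
      rw [abs_mul]
      refine mul_le_mul ?_ (hw k) (abs_nonneg _) (by positivity)
      refine (abs_add_le _ _).trans (add_le_add ?_ ?_)
      · rw [abs_neg]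
        rw [hcs]; exact aux_dot c _ M fun i => hKinv _ _
      · rw [abs_mul]
        exact mul_le_mul hμ (hKinv _ _) (abs_nonneg _) hM.le
    simp only [Finset.sum_const, Finset.card_univ, Fintype.card_fin, nsmul_eq_mul] at this
    calc _ ≤ ε * _ := mul_le_mul_of_nonneg_left this hε.le
      _ = _ := by rw [hE1]; ring
  intro x t ht
  have hεt : ε * t ≤ T₀ := by
    have := ht.2
    rw [le_div_iff₀ hε] at this
    linarith
  have r1 := aux_transport B Bx Bt (T₀ / ε) (ε * μ) _ hT (hBc.differentiableOn (by norm_num))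
    (fun x t ht => (hd1 x t ht).2.2.1) (fun x t ht => (hd1 x t ht).2.2.2) hE x t ht
  have r2 : ∀ a b, |B a 0 - B b 0| ≤ M * |a - b| := fun a b =>
    Convex.norm_image_sub_le_of_norm_hasDerivWithin_le (f := fun y => B y 0) (C := M)
      (fun y _ => ((hd1 y 0 h0T).2.2.1).hasDerivWithinAt (s := univ))
      (fun y _ => (hB0 y).2.1) convex_univ (mem_univ b) (mem_univ a)
  have r3 := r2 (x - ε * μ * t) (x - (l0 - ε * l0 * κ) * ε * t)
  have r4 : |(x - ε * μ * t) - (x - (l0 - ε * l0 * κ) * ε * t)| ≤ ε ^ 2 * E2 * T₀ := by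
    have : (x - ε * μ * t) - (x - (l0 - ε * l0 * κ) * ε * t) =
      -((μ - (l0 - ε * l0 * κ)) * (ε * t)) := by ring
    rw [this, abs_neg, abs_mul, abs_of_nonneg (mul_nonneg hε.le ht.1)]
    exact mul_le_mul hspeed hεt (mul_nonneg hε.le ht.1) (by positivity)
  have r5 : ε ^ 3 * E1 * t ≤ ε ^ 2 * E1 * T₀ := by
    have := mul_le_mul_of_nonneg_left hεt (by positivity : 0 ≤ ε ^ 2 * E1)
    linarith
  have r6 := mul_le_mul_of_nonneg_left r4 hM.le
  have r7 := abs_sub_le (B x t) (B (x - ε * μ * t) 0) (B (x - (l0 - ε * l0 * κ) * ε * t) 0)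
  have r8 : 0 ≤ ε ^ 2 := sq_nonneg _
  linarith
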